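/- arXiv:1002.4466 — 2 statements merged into one kernel-verified Lean document; each statement's English description precedes it below -/
import Mathlib

section
/- Let k be a field, let s ≥ 2 be an integer, let R = k[X, Y, Z]_{(X,Y,Z)} with maximal ideal 𝔪, and let I_s = (Y³, X^{s+1}Y², XY²Z, Y²Z³, X^{2s+1}Y, XYZ², YZ⁵, X^{3s+1}, X²Z, XZ⁴, Z⁷). Then the minimal number of generators of I_s is 11, i.e., the length of I_s/𝔪I_s over R is 11. -/
open MvPolynomial

theorem spanX_isPrime (k : Type*) [Field k] :
    (Ideal.span {MvPolynomial.X 0, MvPolynomial.X 1, MvPolynomial.X 2} :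
      Ideal (MvPolynomial (Fin 3) k)).IsPrime := by
  have himg : (MvPolynomial.X '' (Set.univ : Set (Fin 3)) : Set (MvPolynomial (Fin 3) k)) =
      {MvPolynomial.X 0, MvPolynomial.X 1, MvPolynomial.X 2} := by
    ext p
    simp only [Set.image_univ, Set.mem_range, Set.mem_insert_iff, Set.mem_singleton_iff]
    constructor
    · rintro ⟨i, rfl⟩
      fin_cases i <;> simp
    · rintro (rfl | rfl | rfl)
      exacts [⟨0, rfl⟩, ⟨1, rfl⟩, ⟨2, rfl⟩]
  have h : (Ideal.span {MvPolynomial.X 0, MvPolynomial.X 1, MvPolynomial.X 2} :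
      Ideal (MvPolynomial (Fin 3) k)) = RingHom.ker (constantCoeff (σ := Fin 3) (R := k)) := by
    apply le_antisymm
    · rw [Ideal.span_le]
      rintro p hp
      simp only [Set.mem_insert_iff, Set.mem_singleton_iff] at hp
      rcases hp with rfl | rfl | rfl <;>
        simp [RingHom.mem_ker, constantCoeff_X]
    · intro p hp
      rw [RingHom.mem_ker] at hp
      rw [← himg]
      rw [mem_ideal_span_X_image]
      intro m hm
      by_contra hcon
      push_neg at hcon
      have hm0 : m = 0 := by
        ext i
        simpa using hcon i (Set.mem_univ i)
      rw [hm0] at hm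
      rw [mem_support_iff] at hm
      exact hm (by simpa [constantCoeff_eq] using hp)
  rw [h]
  exact RingHom.ker_isPrime _

instance (k : Type*) [Field k] :
    (Ideal.span {MvPolynomial.X 0, MvPolynomial.X 1, MvPolynomial.X 2} :
      Ideal (MvPolynomial (Fin 3) k)).IsPrime :=
  spanX_isPrime k

/-- Over a local ring, a module with a finite generating family all of whose relations have
coefficients in the maximal ideal needs as many generators as the family has members. -/
theorem Module.length_quotient_maximalIdeal_smul_top {R M ι : Type*} [CommRing R] [IsLocalRing R]
    [AddCommGroup M] [Module R M] [Fintype ι] (g : ι → M)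
    (hspan : Submodule.span R (Set.range g) = ⊤)
    (hrel : ∀ r : ι → R, ∑ i, r i • g i = 0 → ∀ i, r i ∈ IsLocalRing.maximalIdeal R) :
    Module.length R (M ⧸ IsLocalRing.maximalIdeal R • (⊤ : Submodule R M)) = Fintype.card ι := by
  classical
  let m := IsLocalRing.maximalIdeal R
  let f : (ι → R) →ₗ[R] M ⧸ m • (⊤ : Submodule R M) :=
    (m • (⊤ : Submodule R M)).mkQ ∘ₗ Fintype.linearCombination R g
  let q : (ι → R) →ₗ[R] (ι → R ⧸ m) := LinearMap.compLeft m.mkQ ι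
  have hf : Function.Surjective f := by
    refine (Submodule.mkQ_surjective _).comp ?_
    rw [← LinearMap.range_eq_top, Fintype.range_linearCombination, hspan]
  have hq : Function.Surjective q := (Submodule.mkQ_surjective _).comp_left
  have hker : LinearMap.ker f = LinearMap.ker q := by
    ext r
    have hqr : r ∈ LinearMap.ker q ↔ ∀ i, r i ∈ m := by
      simp [q, funext_iff, LinearMap.mem_ker, Ideal.Quotient.eq_zero_iff_mem]
    have hfr : r ∈ LinearMap.ker f ↔ ∑ i, r i • g i ∈ m • (⊤ : Submodule R M) := by
      rw [LinearMap.mem_ker, LinearMap.comp_apply, Submodule.mkQ_apply,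
        Submodule.Quotient.mk_eq_zero, Fintype.linearCombination_apply]
    rw [hqr, hfr]
    constructor
    · intro h
      rw [← hspan, Submodule.mem_ideal_smul_span_iff_exists_sum] at h
      obtain ⟨a, ha, hsum⟩ := h
      rw [Finsupp.sum_fintype _ _ (by simp)] at hsum
      intro i
      rw [← sub_add_cancel (r i) (a i)]
      exact add_mem (hrel (fun i => r i - a i) (by simp [sub_smul, hsum]) i) (ha i)
    · exact fun h => sum_mem fun i _ => Submodule.smul_mem_smul (h i) trivial
  have e : (M ⧸ m • (⊤ : Submodule R M)) ≃ₗ[R] (ι → R ⧸ m) :=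
    (f.quotKerEquivOfSurjective hf).symm ≪≫ₗ Submodule.quotEquivOfEq _ _ hker ≪≫ₗ
      q.quotKerEquivOfSurjective hq
  have : IsSimpleModule R (R ⧸ m) :=
    isSimpleModule_iff_isCoatom.mpr (Ideal.isMaximal_def.mp inferInstance)
  rw [e.length_eq, Module.length_pi, Module.length_eq_one]
  simp

/-- The coefficients of a relation between monomials, none of which divides another, have
constant term zero. -/
theorem MvPolynomial.constantCoeff_eq_zero_of_sum_mul_monomial_eq_zero {σ k ι : Type*}
    [CommSemiring k] [Fintype ι] (e : ι → σ →₀ ℕ) (he : ∀ i j, e i ≤ e j → i = j)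
    (a : ι → MvPolynomial σ k) (h : ∑ i, a i * monomial (e i) 1 = 0) (j : ι) :
    constantCoeff (a j) = 0 := by
  classical
  have := congrArg (coeff (e j)) h
  rw [coeff_sum, Finset.sum_eq_single j] at this
  · simpa [coeff_mul_monomial', constantCoeff_eq] using this
  · intro i _ hij
    rw [coeff_mul_monomial', if_neg fun hle => hij (he i j hle)]
  · simp

theorem mem_spanX_of_constantCoeff_eq_zero {k : Type*} [Field k] {p : MvPolynomial (Fin 3) k}
    (hp : constantCoeff p = 0) :
    p ∈ (Ideal.span {MvPolynomial.X 0, MvPolynomial.X 1, MvPolynomial.X 2} :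
      Ideal (MvPolynomial (Fin 3) k)) := by
  have himg : ({MvPolynomial.X 0, MvPolynomial.X 1, MvPolynomial.X 2} :
      Set (MvPolynomial (Fin 3) k)) = MvPolynomial.X '' Set.univ := by
    ext p
    simp [Fin.exists_fin_succ, eq_comm]
  rw [himg, mem_ideal_span_X_image]
  intro m hm
  by_contra! hcon
  obtain rfl : m = 0 := Finsupp.ext fun i => hcon i trivial
  exact mem_support_iff.mp hm (by simpa [constantCoeff_eq] using hp)

theorem length_map_span_monomial_quotient {k ι : Type*} [Field k] [Fintype ι]
    (e : ι → Fin 3 →₀ ℕ) (he : ∀ i j, e i ≤ e j → i = j)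
    (R : Type*) [CommRing R] [IsLocalRing R] [Algebra (MvPolynomial (Fin 3) k) R]
    [IsLocalization.AtPrime R
      (Ideal.span {MvPolynomial.X 0, MvPolynomial.X 1, MvPolynomial.X 2} :
        Ideal (MvPolynomial (Fin 3) k))]
    (J : Ideal R)
    (hJ : J = Ideal.map (algebraMap (MvPolynomial (Fin 3) k) R)
      (Ideal.span (Set.range fun i => monomial (e i) (1 : k)))) :
    Module.length R (J ⧸ IsLocalRing.maximalIdeal R • (⊤ : Submodule R J)) =
      Fintype.card ι := by
  set P := (Ideal.span {MvPolynomial.X 0, MvPolynomial.X 1, MvPolynomial.X 2} :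
    Ideal (MvPolynomial (Fin 3) k))
  let v : ι → R := fun i => algebraMap _ R (monomial (e i) (1 : k))
  have hJv : J = Submodule.span R (Set.range v) := by
    rw [hJ, Ideal.map_span, ← Set.range_comp]
    rfl
  subst hJv
  refine Module.length_quotient_maximalIdeal_smul_top
    (fun i => ⟨v i, Submodule.subset_span ⟨i, rfl⟩⟩) ?_ ?_
  · apply Submodule.map_injective_of_injective (Submodule.subtype_injective _)
    rw [Submodule.map_span, ← Set.range_comp, Submodule.map_top, Submodule.range_subtype]
    rfl
  intro r hr
  replace hr : ∑ i, r i * v i = 0 := by simpa using congrArg Subtype.val hr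
  obtain ⟨b, hb⟩ := IsLocalization.exist_integer_multiples_of_finite P.primeCompl r
  choose a ha using hb
  have hsum : ∑ i, a i * monomial (e i) (1 : k) = 0 := by
    apply IsLocalization.injective R P.primeCompl_le_nonZeroDivisors
    simp only [map_sum, map_mul, ha, map_zero, smul_mul_assoc]
    rw [← Finset.smul_sum]
    exact (congrArg _ hr).trans (smul_zero _)
  intro i
  have hai : algebraMap _ R (a i) ∈ IsLocalRing.maximalIdeal R :=
    (IsLocalization.AtPrime.to_map_mem_maximal_iff R P _).2 <|
      mem_spanX_of_constantCoeff_eq_zero <|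
        constantCoeff_eq_zero_of_sum_mul_monomial_eq_zero e he a hsum i
  rw [ha, Algebra.smul_def] at hai
  exact (Ideal.unit_mul_mem_iff_mem _ (IsLocalization.map_units R b)).1 hai

/-- The exponents of the eleven monomials generating `Iₛ`. -/
def generatorExponents (s : ℕ) : Fin 11 → Fin 3 → ℕ :=
  ![![0, 3, 0], ![s + 1, 2, 0], ![1, 2, 1], ![0, 2, 3], ![2 * s + 1, 1, 0], ![1, 1, 2],
    ![0, 1, 5], ![3 * s + 1, 0, 0], ![2, 0, 1], ![1, 0, 4], ![0, 0, 7]]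

theorem generatorExponents_antichain {s : ℕ} (hs : 2 ≤ s) (i j : Fin 11)
    (h : generatorExponents s i ≤ generatorExponents s j) : i = j := by
  have h0 := h 0
  have h1 := h 1
  have h2 := h 2
  fin_cases i <;> fin_cases j <;> simp [generatorExponents] at h0 h1 h2 ⊢ <;> omega

theorem monomial_equivFunOnFinite_symm {k : Type*} [CommSemiring k] (v : Fin 3 → ℕ) :
    monomial (Finsupp.equivFunOnFinite.symm v) (1 : k) =
      MvPolynomial.X 0 ^ v 0 * MvPolynomial.X 1 ^ v 1 * MvPolynomial.X 2 ^ v 2 := by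
  rw [monomial_eq, Finsupp.prod_fintype _ _ (by simp)]
  simp [Fin.prod_univ_three]

/-- Let `R = k[X,Y,Z]_{(X,Y,Z)}` (formalized as any localization of
`k[X,Y,Z]` at the prime `(X,Y,Z)`) with maximal ideal `𝔪`, and let `s ≥ 2`.
The minimal number of generators of `Iₛ` is `11`, i.e. the length of `Iₛ/𝔪Iₛ` over `R`
(the Krull dimension of its lattice of `R`-submodules) is `11`. -/
theorem length_I_mod_mI_eq_eleven
    (k : Type*) [Field k] (s : ℕ) (hs : 2 ≤ s)
    (X Y Z : MvPolynomial (Fin 3) k)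
    (hX : X = MvPolynomial.X 0) (hY : Y = MvPolynomial.X 1) (hZ : Z = MvPolynomial.X 2)
    (I : Ideal (MvPolynomial (Fin 3) k))
    (hI : I = Ideal.span {Y ^ 3, X ^ (s + 1) * Y ^ 2, X * Y ^ 2 * Z, Y ^ 2 * Z ^ 3,
      X ^ (2 * s + 1) * Y, X * Y * Z ^ 2, Y * Z ^ 5, X ^ (3 * s + 1), X ^ 2 * Z,
      X * Z ^ 4, Z ^ 7})
    (R : Type*) [CommRing R] [IsLocalRing R] [Algebra (MvPolynomial (Fin 3) k) R]
    [IsLocalization.AtPrime R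
      (Ideal.span {MvPolynomial.X 0, MvPolynomial.X 1, MvPolynomial.X 2} :
        Ideal (MvPolynomial (Fin 3) k))]
    (Iloc : Ideal R)
    (hIloc : Iloc = Ideal.map (algebraMap (MvPolynomial (Fin 3) k) R) I) :
    Order.krullDim
      (Submodule R (Iloc ⧸ (IsLocalRing.maximalIdeal R • (⊤ : Submodule R Iloc)))) = 11 := by
  let e : Fin 11 → Fin 3 →₀ ℕ := fun i => Finsupp.equivFunOnFinite.symm (generatorExponents s i)
  have he : ∀ i j, e i ≤ e j → i = j := fun i j h => generatorExponents_antichain hs i j h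
  have hIe : I = Ideal.span (Set.range fun i => monomial (e i) (1 : k)) := by
    rw [hI, hX, hY, hZ]
    simp only [e, monomial_equivFunOnFinite_symm]
    congr 1
    ext p
    simp [Fin.exists_fin_succ, generatorExponents, eq_comm]
  rw [hIe] at hIloc
  rw [← Module.coe_length, length_map_span_monomial_quotient e he R Iloc hIloc]
  simp
end

section
/- Let k be a field and n ≥ 4 an integer. In the polynomial ring k[X, Y] let I = (X^n, X²Y^{n−2}, XY^{n−1}, Y^n), J = (X^n, Y^n), and r = ⌊n/2⌋. Then X^{n−1}·Y^{n(r−1)+1} ∈ I^r but X^{n−1}·Y^{n(r−1)+1} ∉ J·I^{r−1}. -/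
/-- If `I ≤ A ⊔ B`, then `I ^ s ≤ A ⊔ B ^ s`. -/
theorem Ideal.pow_le_sup_pow_of_le_sup {R : Type*} [CommSemiring R] {I A B : Ideal R}
    (h : I ≤ A ⊔ B) (s : ℕ) : I ^ s ≤ A ⊔ B ^ s := by
  induction s with
  | zero => simp
  | succ s ih =>
    rw [pow_succ, pow_succ]
    refine (Ideal.mul_mono ih h).trans ?_
    rw [Ideal.sup_mul, Ideal.mul_sup (B ^ s)]
    refine sup_le (Ideal.mul_le_left.trans le_sup_left) (sup_le ?_ le_sup_right)
    exact Ideal.mul_le_right.trans le_sup_left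

/-- A monomial `X₀ᵃ X₁ᵇ` with `a < c` and `b < d` is not in the ideal `(X₀ᶜ, X₁ᵈ)`. -/
theorem MvPolynomial.X_pow_mul_X_pow_notMem_span_pair {k : Type*} [CommSemiring k] [Nontrivial k]
    {a b c d : ℕ} (hac : a < c) (hbd : b < d) :
    (X 0 ^ a * X 1 ^ b : MvPolynomial (Fin 2) k) ∉ Ideal.span {X 0 ^ c, X 1 ^ d} := by
  have hspan : ({X 0 ^ c, X 1 ^ d} : Set (MvPolynomial (Fin 2) k)) =
      (fun m => monomial m (1 : k)) '' {Finsupp.single 0 c, Finsupp.single 1 d} := by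
    simp [Set.image_pair, X_pow_eq_monomial]
  have hmon : (X 0 ^ a * X 1 ^ b : MvPolynomial (Fin 2) k) =
      monomial (Finsupp.single 0 a + Finsupp.single 1 b) 1 := by
    simp [X_pow_eq_monomial, monomial_mul]
  rw [hspan, hmon, mem_ideal_span_monomial_image]
  intro h
  obtain ⟨m, hm, hle⟩ := h (Finsupp.single 0 a + Finsupp.single 1 b)
    (by classical simp [mem_support_iff, coeff_monomial])
  rcases hm with rfl | rfl
  · have := hle 0
    simp at this
    omega
  · have := hle 1
    simp at this
    omega

/-- For `n ≥ 4`, with `I = (Xⁿ, X²Y^{n-2}, XY^{n-1}, Yⁿ)`,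
`J = (Xⁿ, Yⁿ)` and `r = ⌊n/2⌋`, the monomial `X^{n-1}·Y^{n(r-1)+1}` lies in `I^r`
but not in `J·I^{r-1}`. -/
theorem mem_pow_not_mem_J_mul_pow
    (k : Type*) [Field k] (n : ℕ) (hn : 4 ≤ n)
    (X Y : MvPolynomial (Fin 2) k)
    (hX : X = MvPolynomial.X 0) (hY : Y = MvPolynomial.X 1)
    (I J : Ideal (MvPolynomial (Fin 2) k))
    (hI : I = Ideal.span {X ^ n, X ^ 2 * Y ^ (n - 2), X * Y ^ (n - 1), Y ^ n})
    (hJ : J = Ideal.span {X ^ n, Y ^ n})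
    (r : ℕ) (hr : r = n / 2) :
    X ^ (n - 1) * Y ^ (n * (r - 1) + 1) ∈ I ^ r ∧
      X ^ (n - 1) * Y ^ (n * (r - 1) + 1) ∉ J * I ^ (r - 1) := by
  obtain ⟨s, rfl⟩ : ∃ s, r = s + 1 := ⟨r - 1, by omega⟩
  obtain ⟨m, rfl⟩ : ∃ m, n = m + 2 := ⟨n - 2, by omega⟩
  simp only [Nat.add_sub_cancel, show m + 2 - 1 = m + 1 by omega] at hI ⊢
  constructor
  · have h2 : X ^ 2 * Y ^ m ∈ I := hI ▸ Ideal.subset_span (by simp)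
    have h1 : X * Y ^ (m + 1) ∈ I := hI ▸ Ideal.subset_span (by simp)
    rw [pow_succ]
    obtain h | h : m = 2 * s ∨ m = 2 * s + 1 := by omega
    · convert Ideal.mul_mem_mul (Ideal.pow_mem_pow h2 s) h1 using 1
      subst h
      ring
    · convert Ideal.mul_mem_mul (Ideal.pow_mem_pow h2 s) h2 using 1
      subst h
      ring
  · have hIle : I ≤ Ideal.span {X ^ (m + 2)} ⊔ Ideal.span {Y ^ m} := by
      have hYmem {p : MvPolynomial (Fin 2) k} (hp : Y ^ m ∣ p) :
          p ∈ Ideal.span {X ^ (m + 2)} ⊔ Ideal.span {Y ^ m} :=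
        Ideal.mem_sup_right (Ideal.mem_span_singleton.2 hp)
      rw [hI, Ideal.span_le]
      rintro p (rfl | rfl | rfl | rfl)
      · exact Ideal.mem_sup_left (Ideal.mem_span_singleton_self _)
      · exact hYmem (dvd_mul_left _ _)
      · exact hYmem ((pow_dvd_pow Y (by omega)).mul_left _)
      · exact hYmem (pow_dvd_pow Y (by omega))
    have hle : J * I ^ s ≤ Ideal.span {X ^ (m + 2), Y ^ (m + 2 + m * s)} := by
      rw [hJ, Ideal.span_insert, Ideal.span_insert, Ideal.sup_mul]
      refine sup_le (Ideal.mul_le_left.trans le_sup_left) ?_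
      refine (Ideal.mul_mono_right (Ideal.pow_le_sup_pow_of_le_sup hIle s)).trans ?_
      rw [Ideal.mul_sup, Ideal.span_singleton_pow, ← pow_mul,
        Ideal.span_singleton_mul_span_singleton (Y ^ _) (Y ^ _), ← pow_add]
      exact sup_le (Ideal.mul_le_right.trans le_sup_left) le_sup_right
    subst hX hY
    refine fun h => MvPolynomial.X_pow_mul_X_pow_notMem_span_pair (by omega) ?_ (hle h)
    have : 2 * s ≤ m := by omega
    linarith [add_mul m 2 s]
end
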